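/- Let T = (T_1,…,T_d) be a commuting row contraction on a complex Hilbert space H and let N ⊆ H be a closed subspace invariant for T (T_k N ⊆ N for all k) such that the restricted tuple (T_1|_N,…,T_d|_N) is a spherical unitary on N. Then N is reducing for T, i.e. T_k* N ⊆ N for every 1 ≤ k ≤ d. -/

import Mathlib

noncomputable section

open ContinuousLinearMap Filter

namespace RowCtr

variable {H : Type*} [NormedAddCommGroup H] [InnerProductSpace ℂ H] [CompleteSpace H]
variable {d : ℕ}

/-- A pairwise commuting tuple of operators. -/
def Commuting (T : Fin d → H →L[ℂ] H) : Prop := ∀ i j, Commute (T i) (T j)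

/-- A commuting row contraction: `∑ Tₖ Tₖ* ≤ 1` in the Loewner order. -/
def IsRowContraction (T : Fin d → H →L[ℂ] H) : Prop :=
  Commuting T ∧ (1 - ∑ k, T k ∘L adjoint (T k)).IsPositive

/-- A spherical unitary: commuting normal operators with `∑ Uₖ Uₖ* = 1`. -/
def IsSphericalUnitary (U : Fin d → H →L[ℂ] H) : Prop :=
  Commuting U ∧ (∀ k, U k ∘L adjoint (U k) = adjoint (U k) ∘L U k) ∧
    (∑ k, U k ∘L adjoint (U k)) = 1

/-- `T^α = T₁^{α₁} ⋯ T_d^{α_d}`. -/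
def mpow (T : Fin d → H →L[ℂ] H) (α : Fin d → ℕ) : H →L[ℂ] H :=
  (List.ofFn fun i => T i ^ α i).prod

/-- `∑_{|α| = N} (N!/α!) ‖T^{*α} ξ‖²`. -/
def defectSum (T : Fin d → H →L[ℂ] H) (N : ℕ) (ξ : H) : ℝ :=
  ∑ α ∈ Finset.Nat.antidiagonalTuple d N,
    (Nat.multinomial Finset.univ α : ℝ) * ‖adjoint (mpow T α) ξ‖ ^ 2

/-- A pure row contraction. -/
def IsPure (T : Fin d → H →L[ℂ] H) : Prop :=
  ∀ ξ : H, Tendsto (fun N => defectSum T N ξ) atTop (nhds 0)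

/-- `N` is invariant under every `T k`. -/
def Invar (T : Fin d → H →L[ℂ] H) (N : Submodule ℂ H) : Prop :=
  ∀ k, ∀ x ∈ N, T k x ∈ N

/-- `N` is reducing for the tuple `T`. -/
def Reduces (T : Fin d → H →L[ℂ] H) (N : Submodule ℂ H) : Prop :=
  Invar T N ∧ ∀ k, ∀ x ∈ N, adjoint (T k) x ∈ N

/-- Restriction of an operator to an invariant subspace. -/
def restrictCLM (f : H →L[ℂ] H) (N : Submodule ℂ H) (h : ∀ x ∈ N, f x ∈ N) :
    N →L[ℂ] N where
  toLinearMap := f.toLinearMap.restrict h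
  cont := (f.continuous.comp continuous_subtype_val).subtype_mk _

/-- Restriction of a tuple to a common invariant subspace. -/
def restrictTuple (T : Fin d → H →L[ℂ] H) (N : Submodule ℂ H) (h : Invar T N) :
    Fin d → N →L[ℂ] N := fun k => restrictCLM (T k) N (h k)

/-- `N` is a closed invariant subspace on which `T` restricts to a spherical unitary. -/
def RestrictsToSphericalUnitary (T : Fin d → H →L[ℂ] H) (N : Submodule ℂ H) : Prop :=
  ∃ (hc : IsClosed (N : Set H)) (hi : Invar T N),
    letI : CompleteSpace N := hc.completeSpace_coe
    IsSphericalUnitary (restrictTuple T N hi)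

/-- A completely non-unitary tuple. -/
def IsCompletelyNonUnitary (T : Fin d → H →L[ℂ] H) : Prop :=
  ∀ N : Submodule ℂ H, RestrictsToSphericalUnitary T N → N = ⊥

end RowCtr

namespace RowCtr

lemma re_inner_sum_comp_adjoint {E : Type*} [NormedAddCommGroup E] [InnerProductSpace ℂ E]
    [CompleteSpace E] {d : ℕ} (T : Fin d → E →L[ℂ] E) (x : E) :
    (inner ℂ ((∑ k, T k ∘L adjoint (T k)) x) x).re = ∑ k, ‖adjoint (T k) x‖ ^ 2 := by
  rw [sum_apply, sum_inner, Complex.re_sum]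
  refine Finset.sum_congr rfl fun k _ => ?_
  rw [comp_apply, ← adjoint_inner_right]
  exact inner_self_eq_norm_sq (𝕜 := ℂ) _

lemma sum_norm_adjoint_sq_le {E : Type*} [NormedAddCommGroup E] [InnerProductSpace ℂ E]
    [CompleteSpace E] {d : ℕ} (T : Fin d → E →L[ℂ] E)
    (hT : (1 - ∑ k, T k ∘L adjoint (T k)).IsPositive) (x : E) :
    ∑ k, ‖adjoint (T k) x‖ ^ 2 ≤ ‖x‖ ^ 2 := by
  have h : 0 ≤ (inner ℂ ((1 - ∑ k, T k ∘L adjoint (T k)) x) x).re :=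
    hT.re_inner_nonneg_left x
  have hx : (inner ℂ x x).re = ‖x‖ ^ 2 := inner_self_eq_norm_sq (𝕜 := ℂ) x
  rw [sub_apply, one_apply_eq_self, inner_sub_left, Complex.sub_re,
    re_inner_sum_comp_adjoint, hx] at h
  linarith

lemma sum_norm_adjoint_sq_eq {E : Type*} [NormedAddCommGroup E] [InnerProductSpace ℂ E]
    [CompleteSpace E] {d : ℕ} (T : Fin d → E →L[ℂ] E)
    (hT : ∑ k, T k ∘L adjoint (T k) = 1) (x : E) :
    ∑ k, ‖adjoint (T k) x‖ ^ 2 = ‖x‖ ^ 2 := by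
  rw [← re_inner_sum_comp_adjoint, hT]
  exact inner_self_eq_norm_sq (𝕜 := ℂ) x

/-- If `N` is a closed invariant subspace of a commuting row contraction `T`
on which `T` restricts to a spherical unitary, then `N` is reducing for `T`. -/
theorem invariant_sphericalUnitary_restriction_reduces
    {H : Type*} [NormedAddCommGroup H] [InnerProductSpace ℂ H] [CompleteSpace H]
    {d : ℕ} (T : Fin d → H →L[ℂ] H) (hT : IsRowContraction T)
    (N : Submodule ℂ H) (hc : IsClosed (N : Set H)) (hi : Invar T N)
    (hsu : letI : CompleteSpace N := hc.completeSpace_coe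
           IsSphericalUnitary (restrictTuple T N hi)) :
    ∀ k, ∀ x ∈ N, ContinuousLinearMap.adjoint (T k) x ∈ N := by
  let : CompleteSpace N := hc.completeSpace_coe
  intro k x hx
  let u : Fin d → N := fun j => adjoint (restrictTuple T N hi j) ⟨x, hx⟩
  have hsum_T : ∑ j, ‖adjoint (T j) x‖ ^ 2 ≤ ‖x‖ ^ 2 :=
    sum_norm_adjoint_sq_le T hT.2 x
  have hsum_u : ∑ j, ‖u j‖ ^ 2 = ‖x‖ ^ 2 :=
    sum_norm_adjoint_sq_eq (restrictTuple T N hi) hsu.2.2 ⟨x, hx⟩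
  have hsub (j : Fin d) :
      ‖adjoint (T j) x - u j‖ ^ 2 = ‖adjoint (T j) x‖ ^ 2 - ‖u j‖ ^ 2 := by
    have hinner : inner ℂ (adjoint (T j) x) (u j : H) = inner ℂ (u j) (u j) := by
      rw [adjoint_inner_left]
      exact (adjoint_inner_left (restrictTuple T N hi j) (u j) ⟨x, hx⟩).symm
    rw [norm_sub_sq (𝕜 := ℂ), hinner, inner_self_eq_norm_sq, Submodule.coe_norm]
    ring
  have hzero : ∑ j, ‖adjoint (T j) x - u j‖ ^ 2 ≤ 0 := by
    simp only [hsub, Finset.sum_sub_distrib]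
    linarith
  have hk : ‖adjoint (T k) x - u k‖ ^ 2 ≤ 0 :=
    (Finset.single_le_sum (f := fun j => ‖adjoint (T j) x - u j‖ ^ 2)
      (fun _ _ => sq_nonneg _) (Finset.mem_univ k)).trans hzero
  have hk_eq : adjoint (T k) x = u k := by
    rw [← sub_eq_zero, ← norm_eq_zero]
    exact pow_eq_zero_iff two_ne_zero |>.1 (le_antisymm hk (sq_nonneg _))
  rw [hk_eq]
  exact (u k).2

end RowCtr
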